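/- For every integer m ≥ 2, d(m, 2m + 13) ≤ 3224; that is, there exists an integral point set of 2m + 13 points in m-dimensional Euclidean space ℝ^m whose diameter is at most 3224. -/

import Mathlib

namespace IntegralPointSet

/-- The point of `ℝ^(n+1)` with height `h` (coordinate `0`) above the base point `v`. -/
noncomputable def liftPoint {n : ℕ} (h : ℝ) (v : Fin n → ℝ) : EuclideanSpace ℝ (Fin (n + 1)) :=
  WithLp.toLp 2 (Fin.cons h v)

lemma dist_liftPoint {n : ℕ} (h k : ℝ) (v w : Fin n → ℝ) :
    dist (liftPoint h v) (liftPoint k w) = √((h - k) ^ 2 + ∑ i, (v i - w i) ^ 2) := by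
  rw [EuclideanSpace.dist_eq, Fin.sum_univ_succ]
  simp [liftPoint, Real.dist_eq, sq_abs]

/-- The two heights used above every vertex of the base simplex. -/
def pairHeight : Bool → ℤ
  | false => 0
  | true => 1748

/-- The fifteen heights used above the apex. -/
def apexHeight : Fin 15 → ℤ :=
  ![-974, -502, -162, -25, 25, 261, 298, 774, 974, 1450, 1487, 1723, 1773, 1910, 2250]

/-- The index type of a configuration of `2 * n + 15` points in `ℝ^(n+1)`. -/
abbrev Index (n : ℕ) : Type := (Fin n × Bool) ⊕ Fin 15

/-- Pairs of points above the vertices `r • e i`, and fifteen points above `(c, …, c)`. -/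
noncomputable def config {n : ℕ} (r c : ℝ) : Index n → EuclideanSpace ℝ (Fin (n + 1))
  | .inl (i, b) => liftPoint (pairHeight b) (Pi.single i r)
  | .inr s => liftPoint (apexHeight s) (fun _ => c)

lemma sum_single_sub_single_sq {n : ℕ} (r : ℝ) {i j : Fin n} (hij : i ≠ j) :
    ∑ k, ((Pi.single i r : Fin n → ℝ) k - (Pi.single j r : Fin n → ℝ) k) ^ 2 = 2 * r ^ 2 := by
  have key : ∀ k, ((Pi.single i r : Fin n → ℝ) k - (Pi.single j r : Fin n → ℝ) k) ^ 2 =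
      (Pi.single i (r ^ 2) : Fin n → ℝ) k + (Pi.single j (r ^ 2) : Fin n → ℝ) k := by
    intro k
    by_cases hi : k = i
    · subst hi; simp [hij]
    · by_cases hj : k = j
      · subst hj; simp [hi]
      · simp [hi, hj]
  simp only [key, Finset.sum_add_distrib, Finset.sum_pi_single', Finset.mem_univ, if_true]
  ring

lemma sum_single_sub_const_sq {n : ℕ} (r c : ℝ) (i : Fin n) :
    ∑ k, ((Pi.single i r : Fin n → ℝ) k - c) ^ 2 = r ^ 2 - 2 * r * c + n * c ^ 2 := by
  have key : ∀ k, ((Pi.single i r : Fin n → ℝ) k - c) ^ 2 =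
      (Pi.single i (r ^ 2 - 2 * r * c) : Fin n → ℝ) k + c ^ 2 := by
    intro k
    by_cases hi : k = i
    · subst hi; simp; ring
    · simp [hi]
  simp only [key, Finset.sum_add_distrib, Finset.sum_pi_single', Finset.mem_univ, if_true]
  simp

lemma sqrt_eq_natCast {x : ℝ} {z : ℕ} (h : x = (z : ℝ) ^ 2) : √x = z := by
  rw [h, Real.sqrt_sq (Nat.cast_nonneg z)]

lemma pairHeight_sub_le (b b' : Bool) : (pairHeight b - pairHeight b').natAbs ≤ 3224 := by
  revert b b'; decide

lemma pairHeight_injective : Function.Injective pairHeight := by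
  decide

lemma apexHeight_sub_le (s t : Fin 15) : (apexHeight s - apexHeight t).natAbs ≤ 3224 := by
  revert s t; decide

lemma apexHeight_injective : Function.Injective apexHeight := by
  decide

lemma exists_hypotenuse_pair (b b' : Bool) :
    ∃ z : ℕ, (pairHeight b - pairHeight b') ^ 2 + 112896 = (z : ℤ) ^ 2 ∧ z ≤ 3224 ∧ 0 < z := by
  refine ⟨if b = b' then 336 else 1780, ?_⟩
  revert b b'; decide

lemma exists_hypotenuse_apex (b : Bool) (s : Fin 15) :
    ∃ z : ℕ, (pairHeight b - apexHeight s) ^ 2 + 554400 = (z : ℤ) ^ 2 ∧ z ≤ 3224 ∧ 0 < z := by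
  refine ⟨bif b then
    ![2822, 2370, 2050, 1923, 1877, 1663, 1630, 1226, 1074, 802, 789, 745, 745, 762, 898] s
    else ![1226, 898, 762, 745, 745, 789, 802, 1074, 1226, 1630, 1663, 1877, 1923, 2050, 2370] s, ?_⟩
  revert b s; decide

lemma exists_dist_config {n : ℕ} {r c : ℝ} (hr : 2 * r ^ 2 = 112896)
    (hc : r ^ 2 - 2 * r * c + n * c ^ 2 = 554400) (x y : Index n) :
    ∃ z : ℕ, dist (config r c x) (config r c y) = z ∧ z ≤ 3224 ∧ (x ≠ y → 0 < z) := by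
  have apex (i : Fin n) (b : Bool) (s : Fin 15) : ∃ z : ℕ,
      dist (config r c (.inl (i, b))) (config r c (.inr s)) = z ∧ z ≤ 3224 ∧ 0 < z := by
    obtain ⟨z, hz, hle, hpos⟩ := exists_hypotenuse_apex b s
    refine ⟨z, ?_, hle, hpos⟩
    rw [config, config, dist_liftPoint, sum_single_sub_const_sq, hc]
    exact sqrt_eq_natCast (by exact_mod_cast hz)
  rcases x with ⟨i, b⟩ | s <;> rcases y with ⟨j, b'⟩ | t
  · by_cases hij : i = j
    · subst hij
      refine ⟨(pairHeight b - pairHeight b').natAbs, ?_, ?_, ?_⟩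
      · rw [config, config, dist_liftPoint]
        simp [Real.sqrt_sq_eq_abs, Nat.cast_natAbs]
      · exact pairHeight_sub_le b b'
      · intro hne
        have : pairHeight b ≠ pairHeight b' := fun h => hne (by rw [pairHeight_injective h])
        omega
    · obtain ⟨z, hz, hle, hpos⟩ := exists_hypotenuse_pair b b'
      refine ⟨z, ?_, hle, fun _ => hpos⟩
      rw [config, config, dist_liftPoint, sum_single_sub_single_sq r hij, hr]
      exact sqrt_eq_natCast (by exact_mod_cast hz)
  · obtain ⟨z, hz, hle, hpos⟩ := apex i b t
    exact ⟨z, hz, hle, fun _ => hpos⟩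
  · obtain ⟨z, hz, hle, hpos⟩ := apex j b' s
    exact ⟨z, by rw [dist_comm, hz], hle, fun _ => hpos⟩
  · refine ⟨(apexHeight s - apexHeight t).natAbs, ?_, ?_, ?_⟩
    · rw [config, config, dist_liftPoint]
      simp [Real.sqrt_sq_eq_abs, Nat.cast_natAbs]
    · exact apexHeight_sub_le s t
    · intro hne
      have : apexHeight s ≠ apexHeight t := fun h => hne (by rw [apexHeight_injective h])
      omega

lemma config_injective {n : ℕ} {r c : ℝ} (hr : 2 * r ^ 2 = 112896)
    (hc : r ^ 2 - 2 * r * c + n * c ^ 2 = 554400) :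
    Function.Injective (config r c : Index n → _) := by
  intro x y hxy
  by_contra hne
  obtain ⟨z, hz, -, hpos⟩ := exists_dist_config hr hc x y
  rw [hxy, dist_self] at hz
  have := hpos hne
  have : z = 0 := by exact_mod_cast hz.symm
  omega

lemma inner_liftPoint {n : ℕ} (h : ℝ) (v : Fin n → ℝ) (w : EuclideanSpace ℝ (Fin (n + 1))) :
    inner ℝ (liftPoint h v) w = h * w 0 + ∑ i : Fin n, v i * w i.succ := by
  simp [PiLp.inner_apply, Fin.sum_univ_succ, liftPoint, mul_comm]

lemma affineSpan_range_config {n : ℕ} (hn : 0 < n) {r c : ℝ} (hr : 0 < r) (hc : c ≤ 0) :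
    affineSpan ℝ (Set.range (config r c : Index n → _)) = ⊤ := by
  have : Nonempty (Index n) := ⟨.inr 0⟩
  rw [AffineSubspace.affineSpan_eq_top_iff_vectorSpan_eq_top_of_nonempty _ _ _
    (Set.range_nonempty _), ← Submodule.orthogonal_eq_bot_iff, Submodule.eq_bot_iff]
  intro w hw
  have eq_inner (x y : Index n) : inner ℝ (config r c x) w = inner ℝ (config r c y) w := by
    have := hw _ (vsub_mem_vectorSpan ℝ (Set.mem_range_self x) (Set.mem_range_self y))
    rwa [vsub_eq_sub, inner_sub_left, sub_eq_zero] at this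
  have inner_pair (i : Fin n) (b : Bool) :
      inner ℝ (config r c (.inl (i, b))) w = pairHeight b * w 0 + r * w i.succ := by
    rw [config, inner_liftPoint]
    simp [Pi.single_apply]
  have hw0 : w 0 = 0 := by
    have h := eq_inner (.inl (⟨0, hn⟩, false)) (.inl (⟨0, hn⟩, true))
    rw [inner_pair, inner_pair] at h
    simp only [pairHeight] at h
    push_cast at h
    linarith
  have coord (i : Fin n) : r * w i.succ = c * ∑ j : Fin n, w j.succ := by
    have h := eq_inner (.inl (i, false)) (.inr 0)
    rw [inner_pair, config, inner_liftPoint, ← Finset.mul_sum, hw0] at h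
    linarith
  have hsum : ∑ j : Fin n, w j.succ = 0 := by
    have h : r * ∑ j : Fin n, w j.succ = n * (c * ∑ j : Fin n, w j.succ) := by
      rw [Finset.mul_sum, Finset.sum_congr rfl fun i _ => coord i]
      simp
    have hpos : 0 < r - n * c := by
      have : (n : ℝ) * c ≤ 0 := mul_nonpos_of_nonneg_of_nonpos (Nat.cast_nonneg n) hc
      linarith
    refine (mul_eq_zero.mp ?_).resolve_left hpos.ne'
    linear_combination h
  ext i
  refine Fin.cases hw0 (fun j => ?_) i
  have h := coord j
  rw [hsum, mul_zero] at h
  exact (mul_eq_zero.mp h).resolve_left hr.ne'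

lemma exists_apex_coordinate {n : ℕ} (hn : 0 < n) {r B : ℝ} (hB : r ^ 2 ≤ B) :
    ∃ c ≤ 0, r ^ 2 - 2 * r * c + n * c ^ 2 = B := by
  have hn' : (0 : ℝ) < n := Nat.cast_pos.mpr hn
  have hprod : 0 ≤ n * (B - r ^ 2) := mul_nonneg hn'.le (sub_nonneg.mpr hB)
  have hsq : √(r ^ 2 + n * (B - r ^ 2)) ^ 2 = r ^ 2 + n * (B - r ^ 2) :=
    Real.sq_sqrt (add_nonneg (sq_nonneg r) hprod)
  refine ⟨(r - √(r ^ 2 + n * (B - r ^ 2))) / n, ?_, ?_⟩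
  · refine div_nonpos_of_nonpos_of_nonneg (sub_nonpos.mpr ?_) hn'.le
    exact Real.le_sqrt_of_sq_le (by linarith)
  · field_simp
    linear_combination hsq

end IntegralPointSet

/-- For every integer `m ≥ 2`, there exists an integral point set of `2 * m + 13` points in
`ℝ^m` (pairwise integral distances, not contained in any affine hyperplane) whose
diameter is at most `3224`; that is, `d(m, 2 * m + 13) ≤ 3224`. -/
theorem d_bound_stmt_15 :
    ∀ m : ℕ, 2 ≤ m →
      ∃ S : Finset (EuclideanSpace ℝ (Fin m)),
        S.card = 2 * m + 13 ∧
        affineSpan ℝ (S : Set (EuclideanSpace ℝ (Fin m))) = ⊤ ∧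
        (∀ p ∈ S, ∀ q ∈ S, ∃ z : ℤ, dist p q = (z : ℝ)) ∧
        Metric.diam (S : Set (EuclideanSpace ℝ (Fin m))) ≤ 3224 := by
  intro m hm
  obtain ⟨n, rfl⟩ : ∃ n, m = n + 1 := ⟨m - 1, by omega⟩
  have hn : 0 < n := by omega
  have hsq : (168 * √2) ^ 2 = (56448 : ℝ) := by
    rw [mul_pow, Real.sq_sqrt zero_le_two]; norm_num
  have hr : 2 * (168 * √2) ^ 2 = (112896 : ℝ) := by rw [hsq]; norm_num
  obtain ⟨c, hc0, hc⟩ := IntegralPointSet.exists_apex_coordinate (B := 554400) hn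
    (show (168 * √2) ^ 2 ≤ _ by rw [hsq]; norm_num)
  let f : IntegralPointSet.Index n → EuclideanSpace ℝ (Fin (n + 1)) :=
    IntegralPointSet.config (168 * √2) c
  have hdist (x y : IntegralPointSet.Index n) := IntegralPointSet.exists_dist_config hr hc x y
  refine ⟨Finset.univ.map ⟨f, IntegralPointSet.config_injective hr hc⟩, ?_, ?_, ?_, ?_⟩
  · simp [Fintype.card_sum]
    omega
  · simpa using IntegralPointSet.affineSpan_range_config hn (by positivity) hc0
  · simp only [Finset.mem_map, Finset.mem_univ, true_and, Function.Embedding.coeFn_mk]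
    rintro _ ⟨x, rfl⟩ _ ⟨y, rfl⟩
    obtain ⟨z, hz, -⟩ := hdist x y
    exact ⟨z, by exact_mod_cast hz⟩
  · refine Metric.diam_le_of_forall_dist_le (by norm_num) ?_
    simp only [Finset.mem_coe, Finset.mem_map, Finset.mem_univ, true_and,
      Function.Embedding.coeFn_mk]
    rintro _ ⟨x, rfl⟩ _ ⟨y, rfl⟩
    obtain ⟨z, hz, hle, -⟩ := hdist x y
    rw [hz]
    exact_mod_cast hle
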